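/- Let W = e^{−Q} ∈ F(C²) with Q even, and suppose the function T(t) = tQ'(t)/Q(t) satisfies lim_{x→∞} T(x) = α for some α ∈ (1, ∞). Then for each ε ∈ (0,1), lim_{n→∞} Q(a_n s)/n = γ_α s^α uniformly for s ∈ [ε, 1], where γ_α = ∫₀¹ t^{α−1}/√(1−t²) dt and a_n is the Mhaskar–Rakhmanov–Saff number. -/

import Mathlib

open MeasureTheory ProbabilityTheory Filter Set Topology
open scoped ENNReal NNReal Classical

noncomputable section

/-- The class `F(C²)` of Levin–Lubinsky: conditions on `Q` (with derivative `Q'` and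
second derivative `Q''` away from the origin) so that `W = e^{-Q} ∈ F(C²)`. -/
structure IsFC2 (Q Q' Q'' : ℝ → ℝ) : Prop where
  nonneg : ∀ x, 0 ≤ Q x
  hasDeriv : ∀ x, HasDerivAt Q (Q' x) x
  contDeriv : Continuous Q'
  zeroAtZero : Q 0 = 0
  monoDeriv : Monotone Q'
  hasDeriv2 : ∀ x ≠ 0, HasDerivAt Q' (Q'' x) x
  tendstoTop : Tendsto Q atTop atTop
  tendstoBot : Tendsto Q atBot atTop
  quasiIncr : ∃ C > 0, ∀ x y : ℝ, 0 < x → x < y →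
      x * Q' x / Q x ≤ C * (y * Q' y / Q y)
  quasiIncrNeg : ∃ C > 0, ∀ x y : ℝ, y < x → x < 0 →
      x * Q' x / Q x ≤ C * (y * Q' y / Q y)
  lambdaBound : ∃ Λ > 1, ∀ t : ℝ, t ≠ 0 → Λ ≤ t * Q' t / Q t
  derivRatio : ∃ C > 0, ∀ x : ℝ, x ≠ 0 → Q'' x / |Q' x| ≤ C * (|Q' x| / Q x)

/-- The Mhaskar–Rakhmanov–Saff numbers `a n > 0` for an even external field `Q`,
defined by `(2/π) ∫₀¹ aₙ t Q'(aₙ t)/√(1-t²) dt = n`. -/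
def IsMRSeven (Q' : ℝ → ℝ) (a : ℕ → ℝ) : Prop :=
  ∀ n : ℕ, 1 ≤ n → 0 < a n ∧
    (2 / Real.pi) * ∫ t in (0:ℝ)..1, a n * t * Q' (a n * t) / Real.sqrt (1 - t ^ 2)
      = (n : ℝ)

lemma aux_beta (p : ℝ) (hp : -1 < p) :
    ∫ t in (0:ℝ)..1, t ^ p / Real.sqrt (1 - t ^ 2) = (1/2) * beta ((p+1)/2) (1/2) := by
  have hb : beta ((p+1)/2) (1/2) = ∫ u in (0:ℝ)..1, u ^ ((p+1)/2 - 1) * (1-u) ^ ((1/2:ℝ) - 1) := by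
    rw [beta_eq_betaIntegralReal _ _ (by linarith) (by norm_num), Complex.betaIntegral]
    have : ∫ x in (0:ℝ)..1, (x:ℂ) ^ ((((p+1)/2 : ℝ):ℂ) - 1) * (1 - (x:ℂ)) ^ (((1/2:ℝ):ℂ) - 1)
        = ((∫ u in (0:ℝ)..1, u ^ ((p+1)/2 - 1) * (1-u) ^ ((1/2:ℝ) - 1) : ℝ) : ℂ) := by
      rw [← intervalIntegral.integral_ofReal]
      apply intervalIntegral.integral_congr
      intro x hx
      rw [uIcc_of_le zero_le_one] at hx
      simp only [Complex.ofReal_mul]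
      rw [Complex.ofReal_cpow hx.1, Complex.ofReal_cpow (by linarith [hx.2])]
      push_cast
      rfl
    rw [this, Complex.ofReal_re]
  rw [hb]
  rw [intervalIntegral.integral_of_le zero_le_one, intervalIntegral.integral_of_le zero_le_one]
  have h := integral_comp_rpow_Ioi_of_pos
    (g := (Ioc (0:ℝ) 1).indicator (fun u : ℝ => u ^ ((p+1)/2 - 1) * (1-u) ^ ((1/2:ℝ) - 1)))
    (p := 2) (by norm_num)
  have e1 : Ioi (0:ℝ) ∩ Ioc 0 1 = Ioc 0 1 := by
    apply inter_eq_right.mpr; intro x hx; exact hx.1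
  rw [setIntegral_indicator measurableSet_Ioc, e1] at h
  rw [← h, ← integral_const_mul]
  have : ∀ x ∈ Ioi (0:ℝ), (2 * x ^ ((2:ℝ) - 1)) • (Ioc (0:ℝ) 1).indicator
      (fun u : ℝ => u ^ ((p+1)/2 - 1) * (1-u) ^ ((1/2:ℝ) - 1)) (x ^ (2:ℝ))
      = (Ioc (0:ℝ) 1).indicator (fun x => 2 * (x ^ p / Real.sqrt (1 - x ^ 2))) x := by
    intro x hx
    have hx0 : 0 < x := hx
    by_cases hx1 : x ≤ 1
    · have m1 : x ∈ Ioc (0:ℝ) 1 := ⟨hx0, hx1⟩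
      have m2 : x ^ (2:ℝ) ∈ Ioc (0:ℝ) 1 :=
        ⟨Real.rpow_pos_of_pos hx0 _, Real.rpow_le_one hx0.le hx1 (by norm_num)⟩
      rw [indicator_of_mem m1, indicator_of_mem m2, smul_eq_mul]
      rw [← Real.rpow_mul hx0.le, Real.rpow_two]
      have e : (1 - x ^ 2) ^ ((1/2:ℝ) - 1) = (Real.sqrt (1 - x^2))⁻¹ := by
        rw [Real.sqrt_eq_rpow, ← Real.rpow_neg (by nlinarith)]
        norm_num
      rw [e]
      have e2 : x ^ p = x ^ ((2:ℝ) - 1) * x ^ (2 * ((p+1)/2 - 1)) := by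
        rw [← Real.rpow_add hx0]; congr 1; ring
      rw [e2, div_eq_mul_inv]; ring
    · have m1 : x ∉ Ioc (0:ℝ) 1 := fun h => hx1 h.2
      have m2 : x ^ (2:ℝ) ∉ Ioc (0:ℝ) 1 := by
        intro h
        have := h.2
        rw [Real.rpow_two] at this
        nlinarith
      rw [indicator_of_notMem m1, indicator_of_notMem m2, smul_zero]
  rw [integral_const_mul, setIntegral_congr_fun measurableSet_Ioi this,
    setIntegral_indicator measurableSet_Ioc, e1, integral_const_mul]
  ring

lemma aux_prod (α : ℝ) (hα : 1 < α) :
    (∫ t in (0:ℝ)..1, t ^ α / Real.sqrt (1 - t ^ 2)) *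
    (∫ t in (0:ℝ)..1, t ^ (α - 1) / Real.sqrt (1 - t ^ 2)) = Real.pi / (2 * α) := by
  rw [aux_beta α (by linarith), aux_beta (α-1) (by linarith)]
  unfold beta
  rw [Real.Gamma_one_half_eq]
  have h1 : (α - 1 + 1) / 2 = α / 2 := by ring
  have h2 : (α + 1) / 2 + 1/2 = α/2 + 1 := by ring
  have h3 : α / 2 + 1/2 = (α+1)/2 := by ring
  rw [h1, h2, h3, Real.Gamma_add_one (by linarith)]
  have g1 := (Real.Gamma_pos_of_pos (show 0 < α/2 by linarith)).ne'
  have g2 := (Real.Gamma_pos_of_pos (show 0 < (α+1)/2 by linarith)).ne'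
  have hp := Real.mul_self_sqrt Real.pi_pos.le
  have : α ≠ 0 := by linarith
  field_simp
  nlinarith [hp]

lemma aux_int : IntervalIntegrable (fun t : ℝ => 1 / Real.sqrt (1 - t ^ 2)) volume 0 1 := by
  apply intervalIntegral.intervalIntegrable_deriv_of_nonneg (g := Real.arcsin)
  · exact Real.continuous_arcsin.continuousOn
  · intro x hx
    simp at hx
    exact Real.hasDerivAt_arcsin (by linarith) (by linarith)
  · intro x hx; positivity

section
variable {Q Q' Q'' : ℝ → ℝ}

lemma aux_pos (h : IsFC2 Q Q' Q'') {x : ℝ} (hx : x ≠ 0) : 0 < Q x := by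
  rcases (h.nonneg x).lt_or_eq with h1 | h1
  · exact h1
  · obtain ⟨L, hL, hb⟩ := h.lambdaBound
    have := hb x hx
    rw [← h1] at this
    simp at this; linarith

lemma aux_pos' (h : IsFC2 Q Q' Q'') {x : ℝ} (hx : 0 < x) : 0 < Q' x := by
  obtain ⟨L, hL, hb⟩ := h.lambdaBound
  have := hb x hx.ne'
  by_contra hn
  have h2 : x * Q' x / Q x ≤ 0 :=
    div_nonpos_of_nonpos_of_nonneg (mul_nonpos_of_nonneg_of_nonpos hx.le (not_lt.mp hn)) (h.nonneg x)
  linarith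

lemma aux_lower (h : IsFC2 Q Q' Q'') {b X : ℝ} (hX : 0 < X)
    (hb : ∀ x ≥ X, b ≤ x * Q' x / Q x) {x s : ℝ} (hs : 0 < s) (hs1 : s ≤ 1) (hxs : X ≤ x * s) :
    Q (x * s) / Q x ≤ s ^ b := by
  have hm : MonotoneOn (fun x => Real.log (Q x) - b * Real.log x) (Ici X) := by
    have hd : ∀ x ∈ Ici X, HasDerivAt (fun x => Real.log (Q x) - b * Real.log x)
        (Q' x / Q x - b * x⁻¹) x := by
      intro x hx
      have hx0 : 0 < x := lt_of_lt_of_le hX hx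
      exact ((h.hasDeriv x).log (aux_pos h hx0.ne').ne').sub
        ((Real.hasDerivAt_log hx0.ne').const_mul b)
    apply monotoneOn_of_deriv_nonneg (convex_Ici X)
    · exact fun x hx => (hd x hx).continuousAt.continuousWithinAt
    · exact fun x hx => (hd x (interior_subset hx)).differentiableAt.differentiableWithinAt
    · intro x hx
      have hx := interior_subset hx
      have hx0 : 0 < x := lt_of_lt_of_le hX hx
      rw [(hd x hx).deriv, sub_nonneg, ← div_eq_mul_inv, div_le_iff₀ hx0]
      have := hb x hx
      rw [div_mul_eq_mul_div, mul_comm (Q' x)]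
      exact this
  have hx0 : 0 < x := by
    by_contra hn
    have := mul_nonpos_of_nonpos_of_nonneg (not_lt.mp hn) hs.le
    linarith
  have hle : x * s ≤ x := by nlinarith
  have := hm (show x * s ∈ Ici X from hxs) (show x ∈ Ici X from hxs.trans hle) hle
  simp only at this
  rw [Real.log_mul hx0.ne' hs.ne'] at this
  have p1 := aux_pos h hx0.ne'
  have p2 := aux_pos h (mul_pos hx0 hs).ne'
  rw [Real.le_rpow_iff_log_le (div_pos p2 p1) hs, Real.log_div p2.ne' p1.ne']
  linarith

lemma aux_upper (h : IsFC2 Q Q' Q'') {b X : ℝ} (hX : 0 < X)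
    (hb : ∀ x ≥ X, x * Q' x / Q x ≤ b) {x s : ℝ} (hs : 0 < s) (hs1 : s ≤ 1) (hxs : X ≤ x * s) :
    s ^ b ≤ Q (x * s) / Q x := by
  have hm : MonotoneOn (fun x => b * Real.log x - Real.log (Q x)) (Ici X) := by
    have hd : ∀ x ∈ Ici X, HasDerivAt (fun x => b * Real.log x - Real.log (Q x))
        (b * x⁻¹ - Q' x / Q x) x := by
      intro x hx
      have hx0 : 0 < x := lt_of_lt_of_le hX hx
      exact ((Real.hasDerivAt_log hx0.ne').const_mul b).sub
        ((h.hasDeriv x).log (aux_pos h hx0.ne').ne')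
    apply monotoneOn_of_deriv_nonneg (convex_Ici X)
    · exact fun x hx => (hd x hx).continuousAt.continuousWithinAt
    · exact fun x hx => (hd x (interior_subset hx)).differentiableAt.differentiableWithinAt
    · intro x hx
      have hx := interior_subset hx
      have hx0 : 0 < x := lt_of_lt_of_le hX hx
      rw [(hd x hx).deriv, sub_nonneg, ← div_eq_mul_inv, le_div_iff₀ hx0]
      have := hb x hx
      rw [div_mul_eq_mul_div, mul_comm (Q' x)]
      exact this
  have hx0 : 0 < x := by
    by_contra hn
    have := mul_nonpos_of_nonpos_of_nonneg (not_lt.mp hn) hs.le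
    linarith
  have hle : x * s ≤ x := by nlinarith
  have := hm (show x * s ∈ Ici X from hxs) (show x ∈ Ici X from hxs.trans hle) hle
  simp only at this
  rw [Real.log_mul hx0.ne' hs.ne'] at this
  have p1 := aux_pos h hx0.ne'
  have p2 := aux_pos h (mul_pos hx0 hs).ne'
  rw [Real.rpow_le_iff_le_log hs (div_pos p2 p1), Real.log_div p2.ne' p1.ne']
  linarith

lemma aux_unif (h : IsFC2 Q Q' Q'') {α : ℝ} (hα : 1 < α)
    (hT : Tendsto (fun x : ℝ => x * Q' x / Q x) atTop (𝓝 α))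
    {ε : ℝ} (hε0 : 0 < ε) :
    TendstoUniformlyOn (fun (x s : ℝ) => Q (x * s) / Q x) (fun s => s ^ α) atTop (Icc ε 1) := by
  rw [Metric.tendstoUniformlyOn_iff]
  intro η hη
  have hc : Tendsto (fun d : ℝ => ε ^ (-d) - 1) (𝓝 0) (𝓝 0) := by
    have : Continuous (fun d : ℝ => ε ^ (-d) - 1) := by
      have := Real.continuous_const_rpow hε0.ne'
      fun_prop
    simpa using this.tendsto 0
  have hc2 : ∀ᶠ d in 𝓝[>] (0:ℝ), ε ^ (-d) - 1 < η :=
    (hc.mono_left nhdsWithin_le_nhds).eventually (gt_mem_nhds hη)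
  obtain ⟨d, hd, hd0⟩ := (hc2.and self_mem_nhdsWithin).exists
  have hd0 : 0 < d := hd0
  have hT' : ∀ᶠ x in atTop, α - d ≤ x * Q' x / Q x ∧ x * Q' x / Q x ≤ α + d :=
    (hT.eventually (Icc_mem_nhds (by linarith) (by linarith)))
  obtain ⟨X0, hX0⟩ := eventually_atTop.mp hT'
  set X := max X0 1 with hXd
  have hX : 0 < X := lt_of_lt_of_le one_pos (le_max_right _ _)
  have hX1 : ∀ x ≥ X, α - d ≤ x * Q' x / Q x ∧ x * Q' x / Q x ≤ α + d :=
    fun x hx => hX0 x ((le_max_left _ _).trans hx)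
  filter_upwards [eventually_ge_atTop (X / ε)] with x hx s hs
  have hs0 : 0 < s := lt_of_lt_of_le hε0 hs.1
  have hx0 : 0 ≤ x := (div_pos hX hε0).le.trans hx
  have hxs : X ≤ x * s := by
    rw [div_le_iff₀ hε0] at hx
    exact hx.trans (mul_le_mul_of_nonneg_left hs.1 hx0)
  have l := aux_lower h hX (fun x hx => (hX1 x hx).1) hs0 hs.2 hxs
  have u := aux_upper h hX (fun x hx => (hX1 x hx).2) hs0 hs.2 hxs
  have f1 : s ^ (α - d) = s ^ α * s ^ (-d) := by rw [← Real.rpow_add hs0]; rfl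
  have f2 : s ^ (α + d) = s ^ α * s ^ d := by rw [← Real.rpow_add hs0]
  have g0 : 0 < s ^ α := Real.rpow_pos_of_pos hs0 _
  have g1 : s ^ α ≤ 1 := Real.rpow_le_one hs0.le hs.2 (by linarith)
  have g2 : s ^ (-d) ≤ ε ^ (-d) := Real.rpow_le_rpow_of_nonpos hε0 hs.1 (by linarith)
  have g3 : s ^ d * s ^ (-d) = 1 := by rw [← Real.rpow_add hs0]; simp
  have g4 : 0 < s ^ d := Real.rpow_pos_of_pos hs0 _
  have g5 : s ^ d ≤ 1 := Real.rpow_le_one hs0.le hs.2 hd0.le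
  have g6 : 1 - s ^ d ≤ s ^ (-d) - 1 := by nlinarith [sq_nonneg (s ^ d - 1)]
  rw [Real.dist_eq, abs_lt]
  rw [f1] at l
  rw [f2] at u
  constructor <;> nlinarith

lemma aux_dct (h : IsFC2 Q Q' Q'') {α : ℝ} (hα : 1 < α)
    (hT : Tendsto (fun x : ℝ => x * Q' x / Q x) atTop (𝓝 α)) :
    Tendsto (fun x : ℝ => (∫ t in (0:ℝ)..1, x * t * Q' (x * t) / Real.sqrt (1 - t ^ 2)) / Q x) atTop
      (𝓝 (α * ∫ t in (0:ℝ)..1, t ^ α / Real.sqrt (1 - t ^ 2))) := by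
  rw [← intervalIntegral.integral_const_mul]
  simp_rw [← intervalIntegral.integral_div]
  have hQ'c := h.contDeriv
  apply intervalIntegral.tendsto_integral_filter_of_dominated_convergence
    (fun t => (α + 1) * (1 / Real.sqrt (1 - t ^ 2)))
  · refine Eventually.of_forall fun x => ?_
    apply Measurable.aestronglyMeasurable
    have := hQ'c.measurable
    fun_prop
  · filter_upwards [hT.eventually (gt_mem_nhds (show α < α + 1 by linarith)),
      eventually_gt_atTop 0] with x hx hx0
    refine Eventually.of_forall fun t ht => ?_
    rw [uIoc_of_le zero_le_one] at ht
    have hq := aux_pos h hx0.ne'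
    have hxt := mul_pos hx0 ht.1
    have hm : Q' (x * t) ≤ Q' x := h.monoDeriv (by nlinarith [ht.2])
    have p1 := aux_pos' h hxt
    rw [Real.norm_of_nonneg (by positivity)]
    have : x * t * Q' (x * t) / Real.sqrt (1 - t ^ 2) / Q x
      = x * t * Q' (x * t) / Q x * (1 / Real.sqrt (1 - t ^ 2)) := by ring
    rw [this]
    apply mul_le_mul_of_nonneg_right _ (by positivity)
    refine le_trans ?_ hx.le
    apply div_le_div_of_nonneg_right _ hq.le
    apply mul_le_mul _ hm p1.le hx0.le
    nlinarith [ht.2]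
  · exact aux_int.const_mul _
  · refine Eventually.of_forall fun t ht => ?_
    rw [uIoc_of_le zero_le_one] at ht
    have h1 : Tendsto (fun x : ℝ => x * t) atTop atTop := tendsto_id.atTop_mul_const ht.1
    have h2 := hT.comp h1
    have h3 := (aux_unif h hα hT ht.1).tendsto_at (show t ∈ Icc t 1 from ⟨le_rfl, ht.2⟩)
    have h4 := (h2.mul h3).mul_const (1 / Real.sqrt (1 - t ^ 2))
    have e : α * t ^ α * (1 / Real.sqrt (1 - t ^ 2)) = α * (t ^ α / Real.sqrt (1 - t ^ 2)) := by ring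
    rw [e] at h4
    refine h4.congr' ?_
    filter_upwards [eventually_gt_atTop 0] with x hx0
    have q1 := (aux_pos h (mul_pos hx0 ht.1).ne').ne'
    simp only [Function.comp]
    field_simp

lemma aux_an (h : IsFC2 Q Q' Q'') {an : ℕ → ℝ} (han : IsMRSeven Q' an) :
    Tendsto an atTop atTop := by
  rw [tendsto_atTop]
  intro A0
  set A := max A0 1
  have hA : 0 < A := lt_of_lt_of_le one_pos (le_max_right _ _)
  set K := (2 / Real.pi) * ∫ t in (0:ℝ)..1, A * Q' A * (1 / Real.sqrt (1 - t ^ 2))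
  filter_upwards [eventually_gt_atTop ⌈K⌉₊, eventually_ge_atTop 1] with n hn hn1
  obtain ⟨ha, he⟩ := han n hn1
  refine (le_max_left A0 1).trans ?_
  by_contra hlt
  have hlt : an n < A := not_le.mp hlt
  have hnK : K < n := Nat.lt_of_ceil_lt hn
  rw [← he] at hnK
  refine absurd hnK (not_lt.mpr ?_)
  apply mul_le_mul_of_nonneg_left _ (by positivity)
  have hint : IntervalIntegrable (fun t : ℝ => an n * t * Q' (an n * t) / Real.sqrt (1 - t ^ 2))
      volume 0 1 := by
    by_contra hni
    rw [intervalIntegral.integral_undef hni] at he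
    have : (1:ℝ) ≤ n := by exact_mod_cast hn1
    simp at he
    linarith
  apply intervalIntegral.integral_mono_on zero_le_one hint (aux_int.const_mul _)
  intro t ht
  rw [div_eq_mul_one_div]
  apply mul_le_mul_of_nonneg_right _ (by positivity)
  have hle : an n * t ≤ A := by nlinarith [ht.1, ht.2]
  have := aux_pos' h hA
  have h0 : 0 ≤ an n * t := mul_nonneg ha.le ht.1
  exact (mul_le_mul_of_nonneg_left (h.monoDeriv hle) h0).trans
    (mul_le_mul_of_nonneg_right hle this.le)
end

/-- The last part of the proof of Theorem 2.4: for `W = e^{-Q} ∈ F(C²)` with `Q` even and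
`T(x) = xQ'(x)/Q(x) → α ∈ (1,∞)`, for every `ε ∈ (0,1)` one has
`lim Q(aₙ s)/n = γ_α s^α` uniformly for `s ∈ [ε,1]`, where
`γ_α = ∫₀¹ t^{α-1}/√(1-t²) dt`. -/
theorem statement_19
    (Q Q' Q'' W : ℝ → ℝ) (hW : ∀ x, W x = Real.exp (-Q x))
    (hFC2 : IsFC2 Q Q' Q'')
    (hQeven : ∀ x, Q (-x) = Q x)
    (α : ℝ) (hα : 1 < α)
    (hT : Tendsto (fun x : ℝ => x * Q' x / Q x) atTop (𝓝 α))
    (an : ℕ → ℝ) (han : IsMRSeven Q' an)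
    (ε : ℝ) (hε0 : 0 < ε) (hε1 : ε < 1) :
    TendstoUniformlyOn (fun (n : ℕ) (s : ℝ) => Q (an n * s) / n)
      (fun s => (∫ t in (0:ℝ)..1, t ^ (α - 1) / Real.sqrt (1 - t ^ 2)) * s ^ α)
      atTop (Set.Icc ε 1) := by
  have hA := aux_an hFC2 han
  have hd := (aux_dct hFC2 hα hT).comp hA
  have hp := aux_prod α hα
  set I := ∫ t in (0:ℝ)..1, t ^ α / Real.sqrt (1 - t ^ 2)
  set γ := ∫ t in (0:ℝ)..1, t ^ (α - 1) / Real.sqrt (1 - t ^ 2)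
  have hpi := Real.pi_pos
  have hI : I ≠ 0 := by
    intro h0
    rw [h0, zero_mul] at hp
    have : 0 < Real.pi / (2 * α) := by positivity
    linarith
  have hα0 : α ≠ 0 := by linarith
  have hγ : Tendsto (fun n : ℕ => Q (an n) / n) atTop (𝓝 γ) := by
    have h1 := (hd.const_mul (2 / Real.pi)).inv₀ (by positivity)
    have e : (2 / Real.pi * (α * I))⁻¹ = γ := by
      have : γ = Real.pi / (2 * α) / I := by rw [← hp]; field_simp
      rw [this]; field_simp
    rw [e] at h1
    refine h1.congr' ?_
    filter_upwards [eventually_ge_atTop 1] with n hn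
    have := (han n hn).2
    simp only [Function.comp]
    rw [← mul_div_assoc, this, inv_div]
  have hγb : ∀ᶠ n : ℕ in atTop, |Q (an n) / n| < |γ| + 1 :=
    hγ.abs.eventually (gt_mem_nhds (by linarith))
  have hu := aux_unif hFC2 hα hT hε0
  rw [Metric.tendstoUniformlyOn_iff] at hu ⊢
  intro η hη
  have hM : 0 < |γ| + 1 := by positivity
  have hu' := hA.eventually (hu (η / 2 / (|γ| + 1)) (by positivity))
  have hγ' := (Metric.tendsto_nhds.mp hγ) (η / 2) (by positivity)
  filter_upwards [hu', hγ', hγb, eventually_ge_atTop 1] with n h1 h2 h3 h4 s hs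
  have h1 := h1 s hs
  have hq := aux_pos hFC2 (han n h4).1.ne'
  rw [Real.dist_eq] at *
  have hs0 : 0 < s := lt_of_lt_of_le hε0 hs.1
  have g0 : 0 < s ^ α := Real.rpow_pos_of_pos hs0 _
  have g1 : s ^ α ≤ 1 := Real.rpow_le_one hs0.le hs.2 (by linarith)
  have e : γ * s ^ α - Q (an n * s) / n =
      (s ^ α - Q (an n * s) / Q (an n)) * (Q (an n) / n) - s ^ α * (Q (an n) / n - γ) := by
    field_simp
    ring
  rw [e]
  refine (abs_sub _ _).trans_lt ?_
  rw [abs_mul, abs_mul, abs_of_pos g0]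
  rw [lt_div_iff₀ hM] at h1
  have b1 : |s ^ α - Q (an n * s) / Q (an n)| * |Q (an n) / n| ≤ 
     |s ^ α - Q (an n * s) / Q (an n)| * (|γ| + 1) :=
    mul_le_mul_of_nonneg_left h3.le (abs_nonneg _)
  have b2 : s ^ α * |Q (an n) / n - γ| ≤ 1 * |Q (an n) / n - γ| :=
    mul_le_mul_of_nonneg_right g1 (abs_nonneg _)
  linarith
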